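/- For every real x ≥ 1000, |𝒰(x)| ≥ (137/60)·x/ln x. -/

import Mathlib

/-- `N ∈ 𝒰` iff `N ≥ 1` and `∑_{n=1}^{N-1} w_n/n ≠ 1/N` for all `w_n ∈ {-1,0,1}`. -/
def memU (N : ℕ) : Prop :=
  1 ≤ N ∧ ∀ w : ℕ → ℤ, (∀ n, w n = -1 ∨ w n = 0 ∨ w n = 1) →
    ∑ n ∈ Finset.Icc 1 (N - 1), (w n : ℚ) / (n : ℚ) ≠ 1 / (N : ℚ)

open scoped Classical

/-- `|𝒰(x)|`: the number of elements of `𝒰` not exceeding `x`. -/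
noncomputable def countU (x : ℝ) : ℕ :=
  ((Finset.Icc 1 ⌊x⌋₊).filter (fun m => memU m)).card

open Real in
lemma h_step {a b : ℝ} (ha : 0 < a) (hb : 0 < b) :
    (b - a) * log a ≤ (b * log b - b) - (a * log a - a) := by
  have h := Real.one_sub_inv_le_log_of_pos (div_pos hb ha)
  rw [Real.log_div hb.ne' ha.ne', inv_div] at h
  have h2 := mul_le_mul_of_nonneg_left h hb.le
  have h3 : b * (1 - a / b) = b - a := by field_simp
  rw [h3] at h2
  nlinarith

open Real in
lemma log_fact_lower (k : ℕ) (hk : 1 ≤ k) :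
    (k : ℝ) * log k - k + 1 ≤ log (k.factorial : ℝ) := by
  induction k, hk using Nat.le_induction with
  | base => simp
  | succ k hk ih =>
    have hk0 : (0 : ℝ) < k := by exact_mod_cast hk
    have := h_step (a := (k : ℝ) + 1) (b := k) (by positivity) hk0
    rw [Nat.factorial_succ]
    push_cast
    rw [Real.log_mul (by positivity) (by positivity)]
    linarith

open Real in
lemma log_fact_upper (k : ℕ) (hk : 1 ≤ k) :
    log (k.factorial : ℝ) ≤ (k : ℝ) * log k - k + 1 + log k := by
  induction k, hk using Nat.le_induction with
  | base => simp
  | succ k hk ih =>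
    have hk0 : (0 : ℝ) < k := by exact_mod_cast hk
    have := h_step (b := (k : ℝ) + 1) (a := k) hk0 (by positivity)
    rw [Nat.factorial_succ]
    push_cast
    rw [Real.log_mul (by positivity) (by positivity)]
    linarith

open Real in
lemma T_upper (y : ℝ) (hy : 1 ≤ y) :
    log ((⌊y⌋₊.factorial : ℕ) : ℝ) ≤ y * log y - y + 1 + log y := by
  have hk : 1 ≤ ⌊y⌋₊ := Nat.one_le_floor_iff _ |>.2 hy
  have hk' : (1 : ℝ) ≤ (⌊y⌋₊ : ℝ) := by exact_mod_cast hk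
  have hle : (⌊y⌋₊ : ℝ) ≤ y := Nat.floor_le (by linarith)
  have h1 := log_fact_upper _ hk
  have h2 := h_step (a := (⌊y⌋₊ : ℝ)) (b := y) (by linarith) (by linarith)
  have h3 := Real.log_le_log (by linarith) hle
  have h4 := Real.log_nonneg hk'
  nlinarith [mul_nonneg (sub_nonneg.2 hle) h4]

open Real in
lemma T_lower (y : ℝ) (hy : 1 ≤ y) :
    y * log y - y - log y ≤ log ((⌊y⌋₊.factorial : ℕ) : ℝ) := by
  have hk : 1 ≤ ⌊y⌋₊ := Nat.one_le_floor_iff _ |>.2 hy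
  have hk' : (1 : ℝ) ≤ (⌊y⌋₊ : ℝ) := by exact_mod_cast hk
  have hle : (⌊y⌋₊ : ℝ) ≤ y := Nat.floor_le (by linarith)
  have hlt : y < (⌊y⌋₊ : ℝ) + 1 := Nat.lt_floor_add_one y
  have h1 := log_fact_lower (⌊y⌋₊ + 1) (by omega)
  rw [Nat.factorial_succ] at h1
  push_cast at h1
  rw [Real.log_mul (by positivity) (by positivity)] at h1
  have h2 := h_step (a := y) (b := (⌊y⌋₊ : ℝ) + 1) (by linarith) (by linarith)
  have h3 : log ((⌊y⌋₊ : ℝ) + 1) ≤ log y + 1 := by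
    have : log ((⌊y⌋₊ : ℝ) + 1) ≤ log (y * 2) := Real.log_le_log (by linarith) (by linarith)
    rw [Real.log_mul (by linarith) (by norm_num)] at this
    have := Real.log_two_lt_d9
    linarith
  have h4 := Real.log_nonneg hy
  nlinarith [mul_nonneg (sub_nonneg.2 hlt.le) h4]

open ArithmeticFunction in
lemma log_fact_eq (N n : ℕ) (h : n ≤ N) :
    Real.log (n.factorial : ℝ) = ∑ d ∈ Finset.Icc 1 N, vonMangoldt d * ((n / d : ℕ) : ℝ) := by
  induction n with
  | zero => simp
  | succ n ih =>
    rw [Nat.factorial_succ]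
    push_cast
    rw [Real.log_mul (by positivity) (by positivity), ih (by omega)]
    have h1 : Real.log ((n : ℝ) + 1) = ∑ d ∈ Finset.Icc 1 N, if d ∣ n + 1 then vonMangoldt d else 0 := by
      rw [← Finset.sum_filter]
      have := vonMangoldt_sum (n := n + 1)
      push_cast at this
      rw [← this]
      apply Finset.sum_congr _ (fun _ _ => rfl)
      ext d
      simp only [Nat.mem_divisors, Finset.mem_filter, Finset.mem_Icc]
      constructor
      · rintro ⟨hd, -⟩
        have := Nat.le_of_dvd (by omega) hd
        have := Nat.pos_of_dvd_of_pos hd (by omega)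
        exact ⟨⟨by omega, by omega⟩, hd⟩
      · rintro ⟨-, hd⟩
        exact ⟨hd, by omega⟩
    rw [h1, ← Finset.sum_add_distrib]
    apply Finset.sum_congr rfl
    intro d _
    rw [Nat.succ_div]
    split_ifs <;> push_cast <;> ring

open ArithmeticFunction in
lemma psi_ge_T (n : ℕ) :
    Real.log (n.factorial : ℝ) - Real.log ((n / 2).factorial : ℝ)
      - Real.log ((n / 3).factorial : ℝ) - Real.log ((n / 5).factorial : ℝ)
      + Real.log ((n / 30).factorial : ℝ) ≤ Chebyshev.psi n := by
  rw [log_fact_eq n n le_rfl, log_fact_eq n (n / 2) (Nat.div_le_self _ _),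
    log_fact_eq n (n / 3) (Nat.div_le_self _ _), log_fact_eq n (n / 5) (Nat.div_le_self _ _),
    log_fact_eq n (n / 30) (Nat.div_le_self _ _), ← Finset.sum_sub_distrib,
    ← Finset.sum_sub_distrib, ← Finset.sum_sub_distrib, ← Finset.sum_add_distrib]
  have : Chebyshev.psi n = ∑ d ∈ Finset.Icc 1 n, vonMangoldt d := by
    simp [Chebyshev.psi, ← Finset.Icc_add_one_left_eq_Ioc]
  rw [this]
  apply Finset.sum_le_sum
  intro d hd
  have h0 : 0 ≤ vonMangoldt d := vonMangoldt_nonneg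
  have hc : ∀ c, n / c / d = (n / d) / c := fun c => by
    rw [Nat.div_div_eq_div_mul, Nat.div_div_eq_div_mul, mul_comm]
  rw [hc, hc, hc, hc]
  generalize n / d = t
  have key : t + t / 30 ≤ 1 + t / 2 + t / 3 + t / 5 := by omega
  have key' : (t : ℝ) + (t / 30 : ℕ) ≤ 1 + (t / 2 : ℕ) + (t / 3 : ℕ) + (t / 5 : ℕ) := by
    exact_mod_cast key
  nlinarith [mul_le_mul_of_nonneg_left key' h0]

open Real in
lemma psi_lower (y : ℝ) (hy : 30 ≤ y) : 0.92 * y - 5 * log y ≤ Chebyshev.psi y := by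
  have h := psi_ge_T ⌊y⌋₊
  have e : ∀ c : ℕ, ⌊y⌋₊ / c = ⌊y / (c : ℝ)⌋₊ := fun c => (Nat.floor_div_natCast y c).symm
  rw [e 2, e 3, e 5, e 30, ← Chebyshev.psi_eq_psi_coe_floor] at h
  push_cast at h
  have h1 := T_lower y (by linarith)
  have h2 := T_upper (y / 2) (by linarith)
  have h3 := T_upper (y / 3) (by linarith)
  have h5 := T_upper (y / 5) (by linarith)
  have h30 := T_lower (y / 30) (by linarith)
  have y0 : y ≠ 0 := by linarith
  rw [Real.log_div y0 (by norm_num)] at h2 h3 h5 h30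
  have l30 : log 30 = log 2 + log 3 + log 5 := by
    rw [← Real.log_mul (by norm_num) (by norm_num), ← Real.log_mul (by norm_num) (by norm_num)]
    norm_num
  rw [l30] at h30
  have l2 := Real.log_two_gt_d9
  have l3 := Real.log_three_gt_d9
  have l5 := Real.log_five_gt_d9
  have hA : 0.92 * y ≤ (14 / 30 * log 2 + 9 / 30 * log 3 + 5 / 30 * log 5) * y := by
    apply mul_le_mul_of_nonneg_right _ (by linarith)
    linarith
  linarith

open Real in
lemma pi_lower (y : ℝ) (hy : 30 ≤ y) : 0.92 * y / log y - 5 ≤ (Nat.primeCounting ⌊y⌋₊ : ℝ) := by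
  have h1 := psi_lower y hy
  have h2 := Chebyshev.psi_le_primeCounting_mul_log' y
  have hl : 0 < log y := Real.log_pos (by linarith)
  rw [div_sub' hl.ne', div_le_iff₀ hl]
  linarith

lemma memU_mul (m L B p : ℕ) (hm : 1 ≤ m) (hp : p.Prime) (hBp : B < p)
    (hL : ∀ k ∈ Finset.Icc 1 m, k ∣ L)
    (hz : ∀ w : ℕ → ℤ, (∀ n, w n = -1 ∨ w n = 0 ∨ w n = 1) →
      ∑ k ∈ Finset.Icc 1 (m - 1), w k * ((L / k : ℕ) : ℤ) - ((L / m : ℕ) : ℤ) ≠ 0 ∧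
      |∑ k ∈ Finset.Icc 1 (m - 1), w k * ((L / k : ℕ) : ℤ) - ((L / m : ℕ) : ℤ)| ≤ B) :
    memU (m * p) := by
  have hp0 : 0 < p := hp.pos
  refine ⟨Nat.mul_pos hm hp0, fun w hw heq => ?_⟩
  have : Fact p.Prime := ⟨hp⟩
  obtain ⟨hz0, hzB⟩ := hz (fun k => w (k * p)) (fun n => hw _)
  set z : ℤ := ∑ k ∈ Finset.Icc 1 (m - 1), w (k * p) * ((L / k : ℕ) : ℤ) - ((L / m : ℕ) : ℤ) with hzdef
  have hcast : ∀ k ∈ Finset.Icc 1 m, ((L / k : ℕ) : ℚ) = (L : ℚ) / k := fun k hk => by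
    rw [Nat.cast_div (hL k hk)]
    have := (Finset.mem_Icc.1 hk).1
    positivity
  rw [← Finset.sum_filter_add_sum_filter_not _ (fun n => p ∣ n)] at heq
  have himg : (Finset.Icc 1 (m * p - 1)).filter (fun n => p ∣ n) =
      (Finset.Icc 1 (m - 1)).image (fun k => k * p) := by
    ext n
    simp only [Finset.mem_filter, Finset.mem_Icc, Finset.mem_image]
    constructor
    · rintro ⟨⟨h1, h2⟩, k, rfl⟩
      refine ⟨k, ⟨?_, ?_⟩, mul_comm _ _⟩
      · exact Nat.pos_of_ne_zero (by rintro rfl; omega)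
      · have : p * k < p * m := by rw [mul_comm p m]; have := Nat.mul_pos hm hp0; omega
        have := lt_of_mul_lt_mul_left this (Nat.zero_le _)
        omega
    · rintro ⟨k, ⟨h1, h2⟩, rfl⟩
      refine ⟨⟨Nat.mul_pos h1 hp0, ?_⟩, dvd_mul_left _ _⟩
      have : k * p < m * p := Nat.mul_lt_mul_of_pos_right (by omega) hp0
      omega
  rw [himg, Finset.sum_image (fun a _ b _ h => Nat.eq_of_mul_eq_mul_right hp0 h)] at heq
  set R : ℚ := ∑ n ∈ (Finset.Icc 1 (m * p - 1)).filter (fun n => ¬ p ∣ n), (w n : ℚ) / (n : ℚ) with hR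
  have hRn : padicNorm p R ≤ 1 := by
    apply padicNorm.sum_le' _ zero_le_one
    intro n hn
    have hn' := (Finset.mem_filter.1 hn).2
    rw [padicNorm.div, (padicNorm.nat_eq_one_iff n).2 hn', div_one]
    exact padicNorm.of_int _
  have hpQ : (p : ℚ) ≠ 0 := by exact_mod_cast hp0.ne'
  have hzR : (z : ℚ) = p * ((-(L : ℤ) : ℤ) * R) := by
    have hS : ∑ k ∈ Finset.Icc 1 (m - 1), (w (k * p) : ℚ) / ((k * p : ℕ) : ℚ) =
        1 / ((m * p : ℕ) : ℚ) - R := by linarith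
    have e1 : ∑ k ∈ Finset.Icc 1 (m - 1), (w (k * p) : ℚ) * ((L / k : ℕ) : ℚ) =
        L * p * ∑ k ∈ Finset.Icc 1 (m - 1), (w (k * p) : ℚ) / ((k * p : ℕ) : ℚ) := by
      rw [Finset.mul_sum]
      apply Finset.sum_congr rfl
      intro k hk
      have hk' := Finset.mem_Icc.1 hk
      have : (k : ℚ) ≠ 0 := by have := hk'.1; positivity
      rw [hcast k (Finset.mem_Icc.2 ⟨hk'.1, by omega⟩)]
      push_cast
      field_simp
    have hmQ : (m : ℚ) ≠ 0 := by positivity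
    rw [hzdef, Int.cast_sub, Int.cast_sum]
    simp only [Int.cast_mul, Int.cast_natCast]
    rw [e1, hS, hcast m (Finset.mem_Icc.2 ⟨hm, le_rfl⟩)]
    push_cast
    field_simp
    ring
  have hdvd : (p : ℤ) ∣ z := by
    rw [← padicNorm.int_lt_one_iff, hzR, padicNorm.mul, padicNorm.mul]
    have a1 := padicNorm.padicNorm_p_lt_one_of_prime (p := p)
    have a2 : padicNorm p ((-(L : ℤ) : ℤ) : ℚ) ≤ 1 := padicNorm.of_int _
    have a3 : padicNorm p ((-(L : ℤ) : ℤ) : ℚ) * padicNorm p R ≤ 1 :=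
      mul_le_one₀ a2 (padicNorm.nonneg _) hRn
    exact lt_of_le_of_lt (mul_le_of_le_one_right (padicNorm.nonneg _) a3) a1
  have := Int.le_of_dvd (abs_pos.2 hz0) ((dvd_abs _ _).2 hdvd)
  omega

def Bd : ℕ → ℕ
  | 1 => 1 | 2 => 3 | 3 => 11 | 4 => 25 | 5 => 137 | 7 => 1089 | 8 => 2283 | _ => 0

def Ms : Finset ℕ := {1, 2, 3, 4, 5, 7, 8}

lemma memU_Ms (m p : ℕ) (hm : m ∈ Ms) (hp : p.Prime) (h : Bd m < p) : memU (m * p) := by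
  simp only [Ms, Finset.mem_insert, Finset.mem_singleton] at hm
  rcases hm with rfl | rfl | rfl | rfl | rfl | rfl | rfl
  · refine memU_mul 1 1 _ p (by norm_num) hp h (by decide) (fun w hw => ?_)
    simp [Bd]
  · refine memU_mul 2 2 _ p (by norm_num) hp h (by decide) (fun w hw => ?_)
    have h1 := hw 1
    simp [Finset.sum_Icc_succ_top, Bd, abs_le]
    omega
  · refine memU_mul 3 6 _ p (by norm_num) hp h (by decide) (fun w hw => ?_)
    have h1 := hw 1
    have h2 := hw 2
    simp [Finset.sum_Icc_succ_top, Bd, abs_le]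
    omega
  · refine memU_mul 4 12 _ p (by norm_num) hp h (by decide) (fun w hw => ?_)
    have h1 := hw 1
    have h2 := hw 2
    have h3 := hw 3
    simp [Finset.sum_Icc_succ_top, Bd, abs_le]
    omega
  · refine memU_mul 5 60 _ p (by norm_num) hp h (by decide) (fun w hw => ?_)
    have hb : ∀ n, -1 ≤ w n ∧ w n ≤ 1 := fun n => by have := hw n; omega
    have h1 := hb 1
    have h2 := hb 2
    have h3 := hb 3
    have h4 := hb 4
    simp [Finset.sum_Icc_succ_top, Bd, abs_le]
    omega
  · refine memU_mul 7 420 _ p (by norm_num) hp h (by decide) (fun w hw => ?_)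
    have hb : ∀ n, -1 ≤ w n ∧ w n ≤ 1 := fun n => by have := hw n; omega
    have h1 := hb 1
    have h2 := hb 2
    have h3 := hb 3
    have h4 := hb 4
    have h5 := hb 5
    have h6 := hb 6
    simp [Finset.sum_Icc_succ_top, Bd, abs_le]
    omega
  · refine memU_mul 8 840 _ p (by norm_num) hp h (by decide) (fun w hw => ?_)
    have hb : ∀ n, -1 ≤ w n ∧ w n ≤ 1 := fun n => by have := hw n; omega
    have h1 := hb 1
    have h2 := hb 2
    have h3 := hb 3
    have h4 := hb 4
    have h5 := hb 5
    have h6 := hb 6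
    have h7 := hb 7
    simp [Finset.sum_Icc_succ_top, Bd, abs_le]
    omega

lemma count_ge (x : ℝ) (hx : 0 ≤ x) :
    ∑ m ∈ Ms, ((Nat.primeCounting ⌊x / (m : ℝ)⌋₊ : ℝ) - (Nat.primeCounting (Bd m) : ℝ))
      ≤ (countU x : ℝ) := by
  have hMB : ∀ m ∈ Ms, 1 ≤ m ∧ m ≤ Bd m := by decide
  let S : ℕ → Finset ℕ := fun m => (Nat.primesLE (⌊x / (m : ℝ)⌋₊) \ Nat.primesLE (Bd m))
  have hS : ∀ m p, p ∈ S m → p.Prime ∧ Bd m < p ∧ p ≤ ⌊x / (m : ℝ)⌋₊ := by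
    intro m p h
    simp only [S, Finset.mem_sdiff, Nat.mem_primesLE] at h
    exact ⟨h.1.2, by by_contra hc; exact h.2 ⟨by omega, h.1.2⟩, h.1.1⟩
  have hdisj : (Ms : Set ℕ).PairwiseDisjoint (fun m => (S m).image (fun p => m * p)) := by
    intro m hm m' hm' hne
    rw [Function.onFun, Finset.disjoint_left]
    intro n hn hn'
    obtain ⟨p, hp, rfl⟩ := Finset.mem_image.1 hn
    obtain ⟨q, hq, hpq⟩ := Finset.mem_image.1 hn'
    obtain ⟨pp, pB, -⟩ := hS _ _ hp
    obtain ⟨qp, qB, -⟩ := hS _ _ hq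
    obtain ⟨a1, a2⟩ := hMB m hm
    obtain ⟨b1, b2⟩ := hMB m' hm'
    by_cases hpq' : q = p
    · subst hpq'
      exact hne (Nat.eq_of_mul_eq_mul_right qp.pos hpq).symm
    · have c1 : p ∣ m' := by
        have : p ∣ m' * q := hpq ▸ dvd_mul_left p m
        rcases pp.dvd_mul.1 this with h | h
        · exact h
        · exact absurd ((Nat.prime_dvd_prime_iff_eq pp qp).1 h).symm hpq'
      have c2 : q ∣ m := by
        have : q ∣ m * p := hpq ▸ dvd_mul_left q m'
        rcases qp.dvd_mul.1 this with h | h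
        · exact h
        · exact absurd ((Nat.prime_dvd_prime_iff_eq qp pp).1 h) hpq'
      have := Nat.le_of_dvd b1 c1
      have := Nat.le_of_dvd a1 c2
      omega
  have hsub : Ms.biUnion (fun m => (S m).image (fun p => m * p)) ⊆
      (Finset.Icc 1 ⌊x⌋₊).filter (fun m => memU m) := by
    intro n hn
    obtain ⟨m, hm, hn⟩ := Finset.mem_biUnion.1 hn
    obtain ⟨p, hp, rfl⟩ := Finset.mem_image.1 hn
    obtain ⟨pp, pB, ple⟩ := hS _ _ hp
    have hU := memU_Ms m p hm pp pB
    refine Finset.mem_filter.2 ⟨Finset.mem_Icc.2 ⟨hU.1, ?_⟩, hU⟩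
    rw [Nat.floor_div_natCast, Nat.le_div_iff_mul_le (hMB m hm).1] at ple
    rwa [mul_comm]
  have hcard := Finset.card_le_card hsub
  rw [Finset.card_biUnion hdisj] at hcard
  have : (∑ m ∈ Ms, (((S m).image (fun p => m * p)).card : ℝ)) ≤ countU x := by
    unfold countU
    exact_mod_cast hcard
  refine le_trans (Finset.sum_le_sum ?_) this
  intro m hm
  rw [Finset.card_image_of_injective _ (fun a b h => Nat.eq_of_mul_eq_mul_left (hMB m hm).1 h)]
  have := Finset.le_card_sdiff (Nat.primesLE (Bd m)) (Nat.primesLE (⌊x / (m : ℝ)⌋₊))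
  rw [Nat.primesLE_card_eq_primeCounting, Nat.primesLE_card_eq_primeCounting] at this
  have h2 : Nat.primeCounting ⌊x / (m : ℝ)⌋₊ ≤ (S m).card + Nat.primeCounting (Bd m) := by
    simp only [S]; omega
  have h3 : (Nat.primeCounting ⌊x / (m : ℝ)⌋₊ : ℝ) ≤ (S m).card + Nat.primeCounting (Bd m) := by
    exact_mod_cast h2
  linarith

def gtest (P n : ℕ) (m B : ℕ) : Bool :=
  Nat.beq (n % m) 0 && (Nat.ble (B + 1) (n / m) && Nat.beq (Nat.gcd (n / m) P) 1)

def good (P n : ℕ) : Bool :=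
  gtest P n 1 1 || (gtest P n 2 3 || (gtest P n 3 11 || (gtest P n 4 25 || gtest P n 5 137)))

def cnt (f : ℕ → Bool) : ℕ → ℕ → ℕ
  | 0, a => bif f a then 1 else 0
  | d + 1, a => cnt f d a + cnt f d (a + 2 ^ d)

lemma cnt_eq (f : ℕ → Bool) (d a : ℕ) :
    cnt f d a = ((Finset.Ico a (a + 2 ^ d)).filter (fun n => f n = true)).card := by
  induction d generalizing a with
  | zero =>
    simp only [cnt, pow_zero, Nat.Ico_succ_singleton, Finset.filter_singleton]
    cases f a <;> simp
  | succ d ih =>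
    have h2d := Nat.two_pow_pos d
    rw [cnt, ih, ih, ← Finset.card_union_of_disjoint, ← Finset.filter_union,
      Finset.Ico_union_Ico_eq_Ico (by omega) (by omega)]
    · congr 3
      ring
    · apply Finset.disjoint_filter_filter
      exact Finset.Ico_disjoint_Ico_consecutive _ _ _

def covers (P r : ℕ) : Prop := ∀ q < r, 2 ≤ q → Nat.gcd q P ≠ 1

lemma prime_of_covers {P r k : ℕ} (hc : covers P r) (hk : 2 ≤ k) (hr : k < r * r)
    (h : Nat.gcd k P = 1) : k.Prime := by
  by_contra hnp
  have h1 := Nat.minFac_sq_le_self (by omega) hnp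
  have h2 : k.minFac < r := by
    by_contra hcc
    push Not at hcc
    nlinarith
  have h3 : (k.minFac).Prime := Nat.minFac_prime (by omega)
  exact hc _ h2 h3.two_le (Nat.Coprime.coprime_dvd_left (Nat.minFac_dvd k) h)

lemma gtest_memU {P r n m B : ℕ} (hc : covers P r) (hr : n < r * r) (hm : m ∈ Ms)
    (hB : Bd m = B) (hB1 : 1 ≤ B) (h : gtest P n m B = true) : memU n := by
  simp only [gtest, Bool.and_eq_true, Nat.beq_eq, Nat.ble_eq] at h
  obtain ⟨h1, h2, h3⟩ := h
  have h4 : m * (n / m) = n := Nat.mul_div_cancel' (Nat.dvd_of_mod_eq_zero h1)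
  rw [← h4]
  apply memU_Ms m _ hm _ (by omega)
  exact prime_of_covers hc (by omega) (lt_of_le_of_lt (Nat.div_le_self _ _) hr) h3

lemma good_memU {P r n : ℕ} (hc : covers P r) (hr : n < r * r) (h : good P n = true) :
    memU n := by
  simp only [good, Bool.or_eq_true] at h
  rcases h with h | h | h | h | h
  · exact gtest_memU hc hr (by decide) rfl (by decide) h
  · exact gtest_memU hc hr (by decide) rfl (by decide) h
  · exact gtest_memU hc hr (by decide) rfl (by decide) h
  · exact gtest_memU hc hr (by decide) rfl (by decide) h
  · exact gtest_memU hc hr (by decide) rfl (by decide) h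

noncomputable def cU (N : ℕ) : ℕ := ((Finset.Icc 1 N).filter (fun m => memU m)).card

lemma cU_step {P r : ℕ} (hc : covers P r) (a d : ℕ) (hr : a + 2 ^ d < r * r) :
    cU a + cnt (good P) d (a + 1) ≤ cU (a + 2 ^ d) := by
  rw [cnt_eq, cU, cU, ← Finset.card_union_of_disjoint]
  · apply Finset.card_le_card
    intro n hn
    have h2d := Nat.two_pow_pos d
    simp only [Finset.mem_union, Finset.mem_filter, Finset.mem_Icc, Finset.mem_Ico] at hn ⊢
    rcases hn with ⟨h1, h2⟩ | ⟨h1, h2⟩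
    · exact ⟨by omega, h2⟩
    · exact ⟨by omega, good_memU hc (by omega) h2⟩
  · rw [Finset.disjoint_left]
    intro n hn hn'
    simp only [Finset.mem_filter, Finset.mem_Icc, Finset.mem_Ico] at hn hn'
    omega

def P1 : ℕ := 200560490130
def P2 : ℕ := 5397346292805549782720214077673687806275517530364350655459511599582614290

lemma cov1 : covers P1 37 := by unfold covers; decide +kernel
lemma cov2 : covers P2 191 := by unfold covers; decide +kernel

lemma base_count : 352 ≤ cU 1000 := by
  have h : cnt (fun n => Nat.ble n 1000 && good P1 n) 10 1 = 352 := by decide +kernel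
  rw [cnt_eq] at h
  rw [← h, cU]
  apply Finset.card_le_card
  intro n hn
  simp only [Finset.mem_filter, Finset.mem_Icc, Finset.mem_Ico, Bool.and_eq_true, Nat.ble_eq] at hn ⊢
  exact ⟨by omega, good_memU cov1 (by omega) hn.2.2⟩

lemma interval_ok {a b C s : ℕ} (ha : 1000 ≤ a) (hC : C ≤ cU a) (hs : 2 ^ s ≤ b ^ 24)
    (hn : 137 * b * 24 * 100000 ≤ 60 * C * s * 69314) (x : ℝ) (hax : (a : ℝ) ≤ x)
    (hxb : x ≤ b) : (137 / 60) * x / Real.log x ≤ (countU x : ℝ) := by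
  have ha' : (1000 : ℝ) ≤ a := by exact_mod_cast ha
  have hcount : (C : ℝ) ≤ countU x := by
    have : cU a ≤ countU x := by
      apply Finset.card_le_card
      apply Finset.filter_subset_filter
      exact Finset.Icc_subset_Icc le_rfl (Nat.le_floor hax)
    exact_mod_cast hC.trans this
  refine le_trans ?_ hcount
  have he : Real.exp 1 ≤ x := by have := Real.exp_one_lt_d9; linarith
  have hx0 : 0 < x := by linarith
  have hb0 : (0 : ℝ) < b := by linarith
  have hlx : 0 < Real.log x := Real.log_pos (by linarith)
  have hanti := Real.log_div_self_antitoneOn (show x ∈ Set.Ici (Real.exp 1) from he)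
    (show (b : ℝ) ∈ Set.Ici (Real.exp 1) from he.trans hxb) hxb
  simp only at hanti
  rw [div_le_div_iff₀ hb0 hx0] at hanti
  have hlb : (s : ℝ) * 0.69314 ≤ 24 * Real.log b := by
    have h1 : ((2 : ℝ) ^ s) ≤ (b : ℝ) ^ 24 := by exact_mod_cast hs
    have h2 := Real.log_le_log (by positivity) h1
    rw [Real.log_pow, Real.log_pow] at h2
    have h3 := Real.log_two_gt_d9
    have h4 : (s : ℝ) * 0.69314 ≤ s * Real.log 2 :=
      mul_le_mul_of_nonneg_left (by linarith) (Nat.cast_nonneg _)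
    push_cast at h2
    linarith
  have hn' : (137 : ℝ) * b * 24 * 100000 ≤ 60 * C * s * 69314 := by exact_mod_cast hn
  have hC0 : (0 : ℝ) ≤ C := Nat.cast_nonneg _
  have h5 : 137 / 60 * (b : ℝ) ≤ C * Real.log b := by
    have := mul_le_mul_of_nonneg_left hlb hC0
    linarith
  rw [div_le_iff₀ hlx]
  have h6 : 137 / 60 * (b : ℝ) * x ≤ C * Real.log x * b := by
    calc 137 / 60 * (b : ℝ) * x ≤ C * Real.log b * x := mul_le_mul_of_nonneg_right h5 hx0.le
      _ = C * (Real.log b * x) := by ring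
      _ ≤ C * (Real.log x * b) := mul_le_mul_of_nonneg_left hanti hC0
      _ = _ := by ring
  have h7 : (137 / 60 * x) * (b : ℝ) ≤ (C * Real.log x) * b := by linarith
  exact le_of_mul_le_mul_right h7 hb0

def ver : List (ℕ × ℕ × ℕ × ℕ) → ℕ → ℕ → Bool
  | [], a, _ => Nat.beq a 32768
  | (a, d, s, C) :: l, a', C' =>
    Nat.beq a a' && (Nat.ble C C' && (Nat.ble (2 ^ s) ((a + 2 ^ d) ^ 24) &&
      (Nat.ble (137 * (a + 2 ^ d) * 24 * 100000) (60 * C * s * 69314) &&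
      (Nat.ble (a + 2 ^ d + 1) 36481 &&
      ver l (a + 2 ^ d) (C + cnt (good P2) d (a + 1))))))

lemma ver_ok (l : List (ℕ × ℕ × ℕ × ℕ)) (a' C' : ℕ) (h : ver l a' C' = true) (ha : 1000 ≤ a')
    (hC : C' ≤ cU a') (x : ℝ) (h1 : (a' : ℝ) ≤ x) (h2 : x ≤ 32768) :
    (137 / 60) * x / Real.log x ≤ (countU x : ℝ) ∨ x = 32768 := by
  induction l generalizing a' C' with
  | nil =>
    simp only [ver, Nat.beq_eq] at h
    subst h
    right
    exact le_antisymm h2 (by exact_mod_cast h1)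
  | cons t l ih =>
    obtain ⟨a, d, s, C⟩ := t
    simp only [ver, Bool.and_eq_true, Nat.beq_eq, Nat.ble_eq] at h
    obtain ⟨rfl, g1, g2, g3, g4, g5⟩ := h
    by_cases hx : x ≤ ((a + 2 ^ d : ℕ) : ℝ)
    · left
      exact interval_ok ha (g1.trans hC) g2 g3 x h1 hx
    · push Not at hx
      refine ih _ _ g5 (ha.trans (Nat.le_add_right _ _)) ?_ hx.le
      have := cU_step cov2 a d (by omega)
      omega

def tbl : List (ℕ × ℕ × ℕ × ℕ) :=
  [(1000, 3, 239, 352), (1008, 4, 240, 354), (1024, 6, 242, 360), (1088, 6, 244, 381), (1152, 6, 245, 405), (1216, 6, 247, 426),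
  (1280, 7, 251, 447), (1408, 7, 254, 492), (1536, 7, 256, 536), (1664, 7, 259, 577), (1792, 7, 261, 620), (1920, 7, 264, 661),
  (2048, 8, 268, 704), (2304, 8, 271, 783), (2560, 8, 275, 864), (2816, 8, 278, 942), (3072, 8, 280, 1023), (3328, 8, 283, 1104),
  (3584, 8, 285, 1180), (3840, 8, 288, 1252), (4096, 9, 292, 1327), (4608, 9, 295, 1477), (5120, 9, 299, 1628), (5632, 9, 302, 1769),
  (6144, 9, 304, 1914), (6656, 9, 307, 2056), (7168, 9, 309, 2201), (7680, 9, 312, 2338), (8192, 10, 316, 2481), (9216, 10, 319, 2751),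
  (10240, 10, 323, 3026), (11264, 10, 326, 3290), (12288, 10, 328, 3559), (13312, 10, 331, 3815), (14336, 10, 333, 4079), (15360, 10, 336, 4346),
  (16384, 11, 340, 4598), (18432, 11, 343, 5113), (20480, 11, 347, 5615), (22528, 11, 350, 6102), (24576, 11, 352, 6602), (26624, 11, 355, 7089),
  (28672, 11, 357, 7580), (30720, 11, 360, 8059)]

lemma ver_tbl : ver tbl 1000 352 = true := by decide +kernel

lemma finite_range (x : ℝ) (h1 : 1000 ≤ x) (h2 : x < 32768) :
    (137 / 60) * x / Real.log x ≤ (countU x : ℝ) := by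
  rcases ver_ok tbl 1000 352 ver_tbl le_rfl base_count x (by exact_mod_cast h1) h2.le with h | h
  · exact h
  · exact absurd h h2.ne

def P3 : ℕ := 614889782588491410

lemma pi_upper (N c : ℕ)
    (h : cnt (fun n => Nat.ble n N && (Nat.ble n 48 || Nat.beq (Nat.gcd n P3) 1)) 12 2 = c)
    (hN : N ≤ 4096) (hP : ∀ q ∈ P3.primeFactors, q ≤ 48) : Nat.primeCounting N ≤ c := by
  rw [cnt_eq] at h
  rw [← h, ← Nat.primesLE_card_eq_primeCounting]
  apply Finset.card_le_card
  intro p hp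
  rw [Nat.mem_primesLE] at hp
  have h2 := hp.2.two_le
  simp only [Finset.mem_filter, Finset.mem_Ico, Bool.and_eq_true, Bool.or_eq_true, Nat.ble_eq,
    Nat.beq_eq]
  refine ⟨by omega, hp.1, ?_⟩
  by_cases hd : p ∣ P3
  · left
    exact hP p (Nat.mem_primeFactors.2 ⟨hp.2, hd, by norm_num [P3]⟩)
  · right
    exact (Nat.Prime.coprime_iff_not_dvd hp.2).2 hd

lemma P3_factors : ∀ q ∈ P3.primeFactors, q ≤ 48 := by
  intro q hq
  have hp := Nat.prime_of_mem_primeFactors hq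
  have hd := Nat.dvd_of_mem_primeFactors hq
  have e : P3 = 2*3*5*7*11*13*17*19*23*29*31*37*41*43*47 := by norm_num [P3]
  rw [e] at hd
  simp only [hp.dvd_mul] at hd
  rcases hd with (((((((((((((h|h)|h)|h)|h)|h)|h)|h)|h)|h)|h)|h)|h)|h)|h <;>
    exact (Nat.le_of_dvd (by norm_num) h).trans (by norm_num)

lemma pi_bounds : Nat.primeCounting 1 = 0 ∧ Nat.primeCounting 3 = 2 ∧ Nat.primeCounting 11 = 5 ∧
    Nat.primeCounting 25 = 9 := by decide

lemma pi137 : Nat.primeCounting 137 ≤ 65 := pi_upper 137 65 (by decide +kernel) (by norm_num) P3_factors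
lemma pi1089 : Nat.primeCounting 1089 ≤ 213 :=
  pi_upper 1089 213 (by decide +kernel) (by norm_num) P3_factors
lemma pi2283 : Nat.primeCounting 2283 ≤ 371 :=
  pi_upper 2283 371 (by decide +kernel) (by norm_num) P3_factors

open Real in
lemma exp_bound (x : ℝ) (hx : 32768 ≤ x) : 10.39 ≤ log x ∧ 300 * log x ^ 2 ≤ x := by
  have l2 := Real.log_two_gt_d9
  have l2' := Real.log_two_lt_d9
  have h0 : log (32768 : ℝ) = 15 * log 2 := by
    rw [show (32768 : ℝ) = 2 ^ 15 by norm_num, Real.log_pow]; norm_num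
  have h1 : log (32768 : ℝ) ≤ log x := Real.log_le_log (by norm_num) hx
  refine ⟨by linarith, ?_⟩
  set t := log x - log (32768 : ℝ) with ht
  have ht0 : 0 ≤ t := by linarith
  have h2 := Real.quadratic_le_exp_of_nonneg ht0
  have h3 : x = 32768 * exp t := by
    rw [ht, Real.exp_sub, Real.exp_log (by linarith), Real.exp_log (by norm_num)]
    field_simp
  have h4 : log x = 15 * log 2 + t := by rw [ht, h0]; ring
  rw [h4]
  have h5 : 32768 * (1 + t + t ^ 2 / 2) ≤ x := by rw [h3]; linarith
  have h6 : (15 * log 2 + t) ^ 2 ≤ (10.3973 + t) ^ 2 := by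
    apply pow_le_pow_left₀ (by positivity)
    linarith
  nlinarith

open Real in
lemma term_bound (x : ℝ) (hx : 32768 ≤ x) (m : ℕ) (hm : 1 ≤ m) (hm8 : m ≤ 8) :
    0.92 * x / m * (1 / log x + log m / log x ^ 2) - 5 ≤ (Nat.primeCounting ⌊x / (m : ℝ)⌋₊ : ℝ) := by
  have hm' : (1 : ℝ) ≤ m := by exact_mod_cast hm
  have hm8' : (m : ℝ) ≤ 8 := by exact_mod_cast hm8
  have hy : 30 ≤ x / (m : ℝ) := by
    rw [le_div_iff₀ (by linarith)]; nlinarith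
  have h := pi_lower (x / m) hy
  have hL : 0 < log x := Real.log_pos (by linarith)
  have hl : 0 < log (x / m) := Real.log_pos (by linarith)
  have hl' : log (x / m) = log x - log m := Real.log_div (by linarith) (by linarith)
  have key : 1 / log x + log m / log x ^ 2 ≤ 1 / log (x / m) := by
    rw [le_div_iff₀ hl, hl']
    have : (1 / log x + log m / log x ^ 2) * (log x - log m) = 1 - (log m / log x) ^ 2 := by
      field_simp
      ring
    rw [this]
    nlinarith [sq_nonneg (log m / log x)]
  have h0 : 0 ≤ 0.92 * x / m := by positivity
  have := mul_le_mul_of_nonneg_left key h0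
  have e : 0.92 * (x / m) / log (x / m) = 0.92 * x / m * (1 / log (x / m)) := by ring
  rw [e] at h
  linarith

open Real in
lemma large_range (x : ℝ) (hx : 32768 ≤ x) :
    (137 / 60) * x / Real.log x ≤ (countU x : ℝ) := by
  refine le_trans ?_ (count_ge x (by linarith))
  obtain ⟨hL, hLx⟩ := exp_bound x hx
  have t1 := term_bound x hx 1 (by norm_num) (by norm_num)
  have t2 := term_bound x hx 2 (by norm_num) (by norm_num)
  have t3 := term_bound x hx 3 (by norm_num) (by norm_num)
  have t4 := term_bound x hx 4 (by norm_num) (by norm_num)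
  have t5 := term_bound x hx 5 (by norm_num) (by norm_num)
  have t7 := term_bound x hx 7 (by norm_num) (by norm_num)
  have t8 := term_bound x hx 8 (by norm_num) (by norm_num)
  obtain ⟨b1, b2, b3, b4⟩ := pi_bounds
  have b5 : (Nat.primeCounting 137 : ℝ) ≤ 65 := by exact_mod_cast pi137
  have b7 : (Nat.primeCounting 1089 : ℝ) ≤ 213 := by exact_mod_cast pi1089
  have b8 : (Nat.primeCounting 2283 : ℝ) ≤ 371 := by exact_mod_cast pi2283
  have hs : ∀ f : ℕ → ℝ, ∑ m ∈ Ms, f m = f 1 + f 2 + f 3 + f 4 + f 5 + f 7 + f 8 := by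
    intro f
    simp [Ms]
    ring
  rw [hs]
  simp only [Bd, b1, b2, b3, b4]
  have l2 := Real.log_two_gt_d9
  have l3 := Real.log_three_gt_d9
  have l5 := Real.log_five_gt_d9
  have l4 : log 4 = 2 * log 2 := by
    rw [show (4 : ℝ) = 2 ^ 2 by norm_num, Real.log_pow]; norm_num
  have l8 : log 8 = 3 * log 2 := by
    rw [show (8 : ℝ) = 2 ^ 3 by norm_num, Real.log_pow]; norm_num
  have l7 : 2.8 * log 2 ≤ log 7 := by
    have : log ((2 : ℝ) ^ 14) ≤ log ((7 : ℝ) ^ 5) := Real.log_le_log (by norm_num) (by norm_num)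
    rw [Real.log_pow, Real.log_pow] at this
    push_cast at this
    linarith
  push_cast at t1 t2 t3 t4 t5 t7 t8 ⊢
  rw [l4] at t4
  rw [l8] at t8
  rw [Real.log_one] at t1
  set L := log x with hLdef
  have hL0 : 0 < L := by linarith
  set u := x / L ^ 2 with hu
  have hu300 : 300 ≤ u := by rw [hu, le_div_iff₀ (by positivity)]; linarith
  have huL : x / L = u * L := by rw [hu]; field_simp
  have conv : ∀ m c : ℝ, 0.92 * x / m * (1 / L + c / L ^ 2) = 0.92 / m * (u * L + c * u) := by
    intro m c
    rw [← huL, hu]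
    ring
  rw [conv] at t1 t2 t3 t4 t5 t7 t8
  have c2 := mul_le_mul_of_nonneg_right l2.le (show 0 ≤ u by linarith)
  have c3 := mul_le_mul_of_nonneg_right l3.le (show 0 ≤ u by linarith)
  have c5 := mul_le_mul_of_nonneg_right l5.le (show 0 ≤ u by linarith)
  have c7 := mul_le_mul_of_nonneg_right l7 (show 0 ≤ u by linarith)
  have cL := mul_le_mul_of_nonneg_left hL (show 0 ≤ u by linarith)
  rw [mul_div_assoc, huL]
  linarith

theorem countU_ge_137_60 (x : ℝ) (hx : 1000 ≤ x) :
    (137 / 60) * x / Real.log x ≤ (countU x : ℝ) := by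
  rcases lt_or_ge x 32768 with h | h
  · exact finite_range x hx h
  · exact large_range x h
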